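/- Let u be harmonic on the open unit ball B ⊂ ℝ^N, q ≥ 1, and γ ∈ (0,1). If ∫_{γ<|x|<1} |u(x)|^q (1−|x|) dx < ∞, then there is a constant c(γ) depending only on γ, N, q such that ∫_B |u(x)|^q (1−|x|) dx ≤ c(γ) ∫_{γ<|x|<1} |u(x)|^q (1−|x|) dx. -/

import Mathlib

open MeasureTheory Metric Set

/-- The Euclidean Laplacian Δf(x) = ∑ᵢ ∂²f/∂xᵢ². -/
noncomputable def eLaplacian (N : ℕ) (f : EuclideanSpace ℝ (Fin N) → ℝ)
    (x : EuclideanSpace ℝ (Fin N)) : ℝ :=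
  ∑ i : Fin N,
    fderiv ℝ (fun y => fderiv ℝ f y (EuclideanSpace.single i 1)) x (EuclideanSpace.single i 1)

/-- f is harmonic on the open set s: it is C² there and its Laplacian vanishes. -/
def IsHarmonicOn (N : ℕ) (f : EuclideanSpace ℝ (Fin N) → ℝ)
    (s : Set (EuclideanSpace ℝ (Fin N))) : Prop :=
  ContDiffOn ℝ 2 f s ∧ ∀ x ∈ s, eLaplacian N f x = 0

/-- A smooth radial function supported in the closed unit ball. -/
noncomputable def radialBump {N : ℕ} (y : EuclideanSpace ℝ (Fin N)) : ℝ :=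
  Real.smoothTransition (1 - ‖y‖ ^ 2)

/-- The nonnegative radial kernel `k` with `∇ radialBump y = - k y • y`. -/
noncomputable def radialKernel {N : ℕ} (y : EuclideanSpace ℝ (Fin N)) : ℝ :=
  2 * deriv Real.smoothTransition (1 - ‖y‖ ^ 2)

lemma contDiff_radialBump {N : ℕ} :
    ContDiff ℝ 2 (radialBump : EuclideanSpace ℝ (Fin N) → ℝ) :=
  (Real.smoothTransition.contDiff (n := 2)).comp (contDiff_const.sub (contDiff_norm_sq ℝ))

lemma radialBump_eq_zero {N : ℕ} {y : EuclideanSpace ℝ (Fin N)} (hy : 1 ≤ ‖y‖) :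
    radialBump y = 0 :=
  Real.smoothTransition.zero_of_nonpos (by nlinarith)

lemma continuous_radialKernel {N : ℕ} :
    Continuous (radialKernel : EuclideanSpace ℝ (Fin N) → ℝ) :=
  continuous_const.mul
    (((Real.smoothTransition.contDiff (n := 1)).continuous_deriv le_rfl).comp (by fun_prop))

lemma radialKernel_nonneg {N : ℕ} (y : EuclideanSpace ℝ (Fin N)) : 0 ≤ radialKernel y :=
  mul_nonneg zero_le_two Real.smoothTransition.monotone.deriv_nonneg

lemma radialKernel_eq_zero {N : ℕ} {y : EuclideanSpace ℝ (Fin N)} (hy : 1 < ‖y‖) :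
    radialKernel y = 0 := by
  have h : Real.smoothTransition =ᶠ[nhds (1 - ‖y‖ ^ 2)] fun _ => 0 := by
    filter_upwards [Iio_mem_nhds (show 1 - ‖y‖ ^ 2 < 0 by nlinarith)] with t ht
    exact Real.smoothTransition.zero_of_nonpos (le_of_lt ht)
  simp [radialKernel, h.deriv_eq]

lemma hasCompactSupport_radialBump {N : ℕ} :
    HasCompactSupport (radialBump : EuclideanSpace ℝ (Fin N) → ℝ) :=
  HasCompactSupport.intro (isCompact_closedBall 0 1) fun y hy =>
    radialBump_eq_zero (by simpa using (not_le.1 (by simpa using hy)).le)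

lemma hasCompactSupport_radialKernel {N : ℕ} :
    HasCompactSupport (radialKernel : EuclideanSpace ℝ (Fin N) → ℝ) :=
  HasCompactSupport.intro (isCompact_closedBall 0 1) fun y hy =>
    radialKernel_eq_zero (by simpa using hy)

/-- The kernel is positive on some sphere centred at the origin. -/
lemma exists_radius_radialKernel_pos (N : ℕ) :
    ∃ s : ℝ, 0 < s ∧ s < 1 ∧
      ∀ y : EuclideanSpace ℝ (Fin N), ‖y‖ = s → 0 < radialKernel y := by
  obtain ⟨c, ⟨hc0, hc1⟩, hc⟩ := exists_hasDerivAt_eq_slope Real.smoothTransition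
    (deriv Real.smoothTransition) zero_lt_one Real.smoothTransition.continuous.continuousOn
    fun x _ => ((Real.smoothTransition.contDiff (n := 1)).differentiable (by simp) x).hasDerivAt
  refine ⟨√(1 - c), Real.sqrt_pos.2 (by linarith), ?_, fun y hy => ?_⟩
  · rw [Real.sqrt_lt' one_pos]; linarith
  · have : 1 - ‖y‖ ^ 2 = c := by rw [hy, Real.sq_sqrt (by linarith)]; ring
    simp [radialKernel, this, hc]

lemma integral_radialKernel_pos {N : ℕ} (hN : 2 ≤ N) :
    0 < ∫ y : EuclideanSpace ℝ (Fin N), radialKernel y := by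
  obtain ⟨s, hs0, -, hs⟩ := exists_radius_radialKernel_pos N
  refine continuous_radialKernel.integral_pos_of_hasCompactSupport_nonneg_nonzero
    hasCompactSupport_radialKernel radialKernel_nonneg
    (x := EuclideanSpace.single ⟨0, by omega⟩ s) (hs _ ?_).ne'
  simp [abs_of_pos hs0]

lemma fderiv_radialBump_single {N : ℕ} (y : EuclideanSpace ℝ (Fin N)) (i : Fin N) :
    fderiv ℝ radialBump y (EuclideanSpace.single i 1) = -(radialKernel y * y i) := by
  have h1 : HasFDerivAt (fun y : EuclideanSpace ℝ (Fin N) => 1 - ‖y‖ ^ 2)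
      (-(2 • innerSL ℝ y)) y := by
    simpa using (hasStrictFDerivAt_norm_sq y).hasFDerivAt.const_sub 1
  have h2 := ((Real.smoothTransition.contDiff (n := 1)).differentiable
    (by simp) (1 - ‖y‖ ^ 2)).hasDerivAt.comp_hasFDerivAt y h1
  have h3 : HasFDerivAt (radialBump : EuclideanSpace ℝ (Fin N) → ℝ) _ y := h2
  rw [h3.fderiv]
  simp [radialKernel, EuclideanSpace.inner_single_right]
  ring

/-- The derivative of the dilated average vanishes: integrate by parts against `radialBump`. -/
lemma integral_radialKernel_mul_fderiv_eq_zero {N : ℕ} {v : EuclideanSpace ℝ (Fin N) → ℝ}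
    (hv : ContDiff ℝ 2 v) {x : EuclideanSpace ℝ (Fin N)} {t : ℝ}
    (hΔ : ∀ y ∈ ball (0 : EuclideanSpace ℝ (Fin N)) 1, eLaplacian N v (x + t • y) = 0) :
    ∫ y, radialKernel y * fderiv ℝ v (x + t • y) y = 0 := by
  have hφ := contDiff_radialBump (N := N)
  have hc := hasCompactSupport_radialBump (N := N)
  let D : Fin N → EuclideanSpace ℝ (Fin N) → ℝ :=
    fun i z => fderiv ℝ v z (EuclideanSpace.single i 1)
  have hD : ∀ i, ContDiff ℝ 1 (D i) := fun i =>
    (hv.fderiv_right (m := 1) (by norm_num)).clm_apply contDiff_const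
  have hDt : ∀ i, ContDiff ℝ 1 fun y => D i (x + t • y) := fun i =>
    (hD i).comp (by fun_prop)
  have hder : ∀ i y, fderiv ℝ (fun y => D i (x + t • y)) y (EuclideanSpace.single i 1) =
      t * fderiv ℝ (D i) (x + t • y) (EuclideanSpace.single i 1) := by
    intro i y
    have h1 : HasFDerivAt (fun y : EuclideanSpace ℝ (Fin N) => x + t • y)
        (t • ContinuousLinearMap.id ℝ _) y :=
      ((hasFDerivAt_id y).const_smul t).const_add x
    have h2 := (((hD i).differentiable (by simp)) (x + t • y)).hasFDerivAt.comp y h1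
    have h3 : fderiv ℝ (fun y => D i (x + t • y)) y = _ := h2.fderiv
    rw [h3]
    simp
  have hint1 : ∀ i, Integrable fun y => radialBump y *
      fderiv ℝ (fun y => D i (x + t • y)) y (EuclideanSpace.single i 1) := fun i =>
    (hφ.continuous.mul (((hDt i).continuous_fderiv (by simp)).clm_apply
      continuous_const)).integrable_of_hasCompactSupport hc.mul_right
  have hcd : ∀ i, HasCompactSupport fun y : EuclideanSpace ℝ (Fin N) =>
      fderiv ℝ radialBump y (EuclideanSpace.single i 1) := fun i =>
    hc.fderiv_apply ℝ _
  have hint2 : ∀ i, Integrable fun y =>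
      fderiv ℝ radialBump y (EuclideanSpace.single i 1) * D i (x + t • y) := fun i =>
    (((hφ.continuous_fderiv (by simp)).clm_apply continuous_const).mul
      (hDt i).continuous).integrable_of_hasCompactSupport (hcd i).mul_right
  have hint3 : ∀ i, Integrable fun y => radialBump y * D i (x + t • y) := fun i =>
    (hφ.continuous.mul (hDt i).continuous).integrable_of_hasCompactSupport hc.mul_right
  have hparts := fun i => integral_mul_fderiv_eq_neg_fderiv_mul_of_integrable
    (hint2 i) (hint1 i) (hint3 i) (fun y _ => hφ.differentiable (by simp) y)
    (fun y _ => (hDt i).differentiable (by simp) y)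
  have hpt : ∀ y, radialKernel y * fderiv ℝ v (x + t • y) y =
      ∑ i, -(fderiv ℝ radialBump y (EuclideanSpace.single i 1) * D i (x + t • y)) := by
    intro y
    have hy : y = ∑ i, y i • EuclideanSpace.single i (1 : ℝ) := by
      simpa using ((EuclideanSpace.basisFun (Fin N) ℝ).sum_repr y).symm
    have : fderiv ℝ v (x + t • y) y = ∑ i, y i * D i (x + t • y) := by
      conv_lhs => rw [hy]
      rw [map_sum]
      simp only [map_smul, smul_eq_mul]
      rw [← hy]
    rw [this, Finset.mul_sum]
    refine Finset.sum_congr rfl fun i _ => ?_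
    rw [fderiv_radialBump_single]
    ring
  simp_rw [hpt]
  rw [integral_finsetSum (f := fun i y => -(fderiv ℝ radialBump y (EuclideanSpace.single i 1) *
    D i (x + t • y))) _ fun i _ => (hint2 i).neg]
  simp_rw [integral_neg, ← hparts]
  rw [← integral_finsetSum _ fun i _ => hint1 i]
  refine integral_eq_zero_of_ae (Filter.Eventually.of_forall fun y => ?_)
  simp only [hder, Pi.zero_apply]
  rw [← Finset.mul_sum, ← Finset.mul_sum]
  rcases lt_or_ge ‖y‖ 1 with hy | hy
  · have := hΔ y (by simpa using hy)
    rw [eLaplacian] at this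
    simp [D, this]
  · simp [radialBump_eq_zero hy]

lemma integral_radialKernel_mul_eq_of_hasCompactSupport {N : ℕ}
    {v : EuclideanSpace ℝ (Fin N) → ℝ}
    (hv : ContDiff ℝ 2 v) (hvc : HasCompactSupport v) {x : EuclideanSpace ℝ (Fin N)} {δ : ℝ}
    (hδ : 0 ≤ δ) (hΔ : ∀ z ∈ ball x δ, eLaplacian N v z = 0) :
    ∫ y, radialKernel y * v (x + δ • y) =
      v x * ∫ y : EuclideanSpace ℝ (Fin N), radialKernel y := by
  have hk := continuous_radialKernel (N := N)
  have hkc := hasCompactSupport_radialKernel (N := N)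
  have hd : Continuous (fderiv ℝ v) := hv.continuous_fderiv (by simp)
  obtain ⟨C, hC⟩ := (hvc.fderiv ℝ).exists_bound_of_continuous hd
  have key : ∀ t, HasDerivAt (fun t : ℝ => ∫ y, radialKernel y * v (x + t • y))
      (∫ y, radialKernel y * fderiv ℝ v (x + t • y) y) t := by
    intro t
    refine (hasDerivAt_integral_of_dominated_loc_of_deriv_le (𝕜 := ℝ) (s := univ)
      (F := fun t y => radialKernel y * v (x + t • y))
      (F' := fun t y => radialKernel y * fderiv ℝ v (x + t • y) y)
      (bound := fun y => radialKernel y * C)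
      Filter.univ_mem ?_ ?_ ?_ ?_ ?_ ?_).2
    · refine Filter.Eventually.of_forall fun t => Continuous.aestronglyMeasurable ?_
      exact hk.mul (hv.continuous.comp (by fun_prop))
    · exact (hk.mul (hv.continuous.comp (by fun_prop))).integrable_of_hasCompactSupport
        hkc.mul_right
    · exact (hk.mul ((hd.comp (by fun_prop)).clm_apply continuous_id)).aestronglyMeasurable
    · refine Filter.Eventually.of_forall fun y s _ => ?_
      rw [norm_mul, Real.norm_of_nonneg (radialKernel_nonneg y)]
      rcases le_or_gt ‖y‖ 1 with hy | hy
      · refine mul_le_mul_of_nonneg_left ?_ (radialKernel_nonneg y)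
        calc ‖fderiv ℝ v (x + s • y) y‖ ≤ ‖fderiv ℝ v (x + s • y)‖ * ‖y‖ :=
              ContinuousLinearMap.le_opNorm _ _
          _ ≤ ‖fderiv ℝ v (x + s • y)‖ * 1 := by gcongr
          _ ≤ C := by simpa using hC _
      · simp [radialKernel_eq_zero hy]
    · exact (hk.mul continuous_const).integrable_of_hasCompactSupport hkc.mul_right
    · refine Filter.Eventually.of_forall fun y s _ => ?_
      have h1 : HasDerivAt (fun s : ℝ => x + s • y) y s := by
        simpa using ((hasDerivAt_id s).smul_const y).const_add x
      exact ((hv.differentiable (by simp) _).hasFDerivAt.comp_hasDerivAt s h1).const_mul _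
  have hconst := constant_of_has_deriv_right_zero
    (f := fun t : ℝ => ∫ y, radialKernel y * v (x + t • y)) (a := 0) (b := δ)
    (fun t _ => (key t).continuousAt.continuousWithinAt) (fun t ht => by
      have h0 := key t
      rw [integral_radialKernel_mul_fderiv_eq_zero hv fun y hy => hΔ _ ?_] at h0
      · exact h0.hasDerivWithinAt
      · have hy' : ‖y‖ < 1 := by simpa using hy
        rw [mem_ball, dist_eq_norm, add_sub_cancel_left, norm_smul, Real.norm_of_nonneg ht.1]
        nlinarith [ht.1, ht.2, norm_nonneg y]) δ (right_mem_Icc.2 hδ)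
  simp only [zero_smul, add_zero] at hconst
  rw [hconst, integral_mul_const, mul_comm]

lemma Filter.EventuallyEq.eLaplacian_eq {N : ℕ} {f g : EuclideanSpace ℝ (Fin N) → ℝ}
    {x : EuclideanSpace ℝ (Fin N)} (h : f =ᶠ[nhds x] g) :
    eLaplacian N f x = eLaplacian N g x := by
  unfold eLaplacian
  refine Finset.sum_congr rfl fun i _ => ?_
  rw [Filter.EventuallyEq.fderiv_eq]
  filter_upwards [h.fderiv (𝕜 := ℝ)] with y hy
  rw [hy]

/-- A smoothly weighted mean value property of harmonic functions. -/
lemma IsHarmonicOn.integral_radialKernel_mul {N : ℕ} {u : EuclideanSpace ℝ (Fin N) → ℝ}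
    (hu : IsHarmonicOn N u (ball 0 1)) {x : EuclideanSpace ℝ (Fin N)} {δ : ℝ}
    (hδ : 0 < δ) (hx : ‖x‖ + δ < 1) :
    ∫ y, radialKernel y * u (x + δ • y) =
      u x * ∫ y : EuclideanSpace ℝ (Fin N), radialKernel y := by
  obtain ⟨R, hR, hR1⟩ := exists_between hx
  have hR0 : 0 < R := by linarith [norm_nonneg x]
  let χ : ContDiffBump (0 : EuclideanSpace ℝ (Fin N)) := ⟨R, (R + 1) / 2, hR0, by linarith⟩
  have hin : χ.rIn = R := rfl
  let v : EuclideanSpace ℝ (Fin N) → ℝ := fun z => χ z * u z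
  have heq : ∀ z ∈ ball (0 : EuclideanSpace ℝ (Fin N)) R, v z = u z := fun z hz => by
    simp [v, χ.one_of_mem_closedBall (by rw [hin]; exact ball_subset_closedBall hz)]
  have hsub : ∀ z, ‖z - x‖ ≤ δ → z ∈ ball (0 : EuclideanSpace ℝ (Fin N)) R := fun z hz => by
    rw [mem_ball_zero_iff]
    have := norm_le_norm_add_norm_sub' z x
    linarith
  have hvc : HasCompactSupport v := χ.hasCompactSupport.mul_right
  have hv : ContDiff ℝ 2 v := by
    rw [contDiff_iff_contDiffAt]
    intro z
    rcases lt_or_ge ‖z‖ 1 with hz | hz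
    · exact (χ.contDiff (n := 2)).contDiffAt.mul
        (hu.1.contDiffAt (isOpen_ball.mem_nhds (by simpa using hz)))
    · have h0 : v =ᶠ[nhds z] fun _ => 0 := by
        have : z ∈ (closedBall (0 : EuclideanSpace ℝ (Fin N)) ((R + 1) / 2))ᶜ := by
          rw [mem_compl_iff, mem_closedBall_zero_iff]
          exact not_le.2 (by linarith)
        filter_upwards [isClosed_closedBall.isOpen_compl.mem_nhds this] with w hw
        have hw' : χ.rOut ≤ dist w 0 := by
          rw [mem_compl_iff, mem_closedBall, not_le] at hw
          exact hw.le
        simp [v, χ.zero_of_le_dist hw']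
      exact contDiffAt_const.congr_of_eventuallyEq h0
  have hmean := integral_radialKernel_mul_eq_of_hasCompactSupport hv hvc hδ.le
    (x := x) fun z hz => by
      have hzR := hsub z (by simpa [dist_eq_norm] using (mem_ball.1 hz).le)
      rw [Filter.EventuallyEq.eLaplacian_eq (g := u)
        (Filter.eventually_of_mem (isOpen_ball.mem_nhds hzR) heq)]
      exact hu.2 z (ball_subset_ball hR1.le hzR)
  rw [heq x (hsub x (by simpa using hδ.le))] at hmean
  rw [← hmean]
  refine integral_congr_ae (Filter.Eventually.of_forall fun y => ?_)
  rcases le_or_gt ‖y‖ 1 with hy | hy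
  · simp only
    rw [heq _ (hsub _ _)]
    rw [add_sub_cancel_left, norm_smul, Real.norm_of_nonneg hδ.le]
    nlinarith
  · simp [radialKernel_eq_zero hy]

lemma norm_add_smul_sub_le {E : Type*} [NormedAddCommGroup E] [NormedSpace ℝ E] {x y : E} {δ : ℝ}
    (hδ : 0 ≤ δ) (hy : ‖y‖ ≤ 1) :
    ‖x‖ - δ ≤ ‖x + δ • y‖ ∧ ‖x + δ • y‖ ≤ ‖x‖ + δ := by
  have h1 : ‖δ • y‖ ≤ δ := by
    rw [norm_smul, Real.norm_of_nonneg hδ]; exact mul_le_of_le_one_right hδ hy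
  have h2 := norm_add_le x (δ • y)
  have h3 := norm_sub_le (x + δ • y) (δ • y)
  rw [add_sub_cancel_right] at h3
  exact ⟨by linarith, by linarith⟩

lemma integrable_radialKernel_mul {N : ℕ} {g : EuclideanSpace ℝ (Fin N) → ℝ}
    (hg : ContinuousOn g (ball 0 1)) {x : EuclideanSpace ℝ (Fin N)} {δ : ℝ}
    (hδ : 0 < δ) (hx : ‖x‖ + δ < 1) :
    Integrable fun y => radialKernel y * g (x + δ • y) := by
  rw [← integrableOn_iff_integrable_of_support_subset (s := closedBall 0 1)]
  · refine ContinuousOn.integrableOn_compact (isCompact_closedBall 0 1) ?_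
    refine continuous_radialKernel.continuousOn.mul (hg.comp (by fun_prop) fun y hy => ?_)
    rw [mem_ball_zero_iff]
    linarith [(norm_add_smul_sub_le (x := x) hδ.le (by simpa using hy)).2]
  · intro y hy
    by_contra h
    exact hy (by simp [radialKernel_eq_zero (by simpa using h)])

lemma IsHarmonicOn.abs_mul_integral_radialKernel_le {N : ℕ}
    {u : EuclideanSpace ℝ (Fin N) → ℝ} (hu : IsHarmonicOn N u (ball 0 1))
    {x : EuclideanSpace ℝ (Fin N)} {δ : ℝ} (hδ : 0 < δ) (hx : ‖x‖ + δ < 1) :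
    |u x| * ∫ y : EuclideanSpace ℝ (Fin N), radialKernel y ≤
      ∫ y, radialKernel y * |u (x + δ • y)| := by
  have h0 : 0 ≤ ∫ y : EuclideanSpace ℝ (Fin N), radialKernel y :=
    integral_nonneg radialKernel_nonneg
  rw [← abs_of_nonneg h0, ← abs_mul, ← hu.integral_radialKernel_mul hδ hx]
  refine abs_integral_le_integral_abs.trans_eq ?_
  simp_rw [abs_mul, abs_of_nonneg (radialKernel_nonneg _)]

/-- The weighted mean value inequality for `|u| ^ q`. -/
lemma IsHarmonicOn.abs_rpow_mul_integral_radialKernel_le {N : ℕ}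
    {u : EuclideanSpace ℝ (Fin N) → ℝ} (hu : IsHarmonicOn N u (ball 0 1)) {q : ℝ} (hq : 1 ≤ q)
    {x : EuclideanSpace ℝ (Fin N)} {δ : ℝ} (hδ : 0 < δ) (hx : ‖x‖ + δ < 1) :
    |u x| ^ q * ∫ y : EuclideanSpace ℝ (Fin N), radialKernel y ≤
      ∫ y, radialKernel y * |u (x + δ • y)| ^ q := by
  have hpow : Integrable fun y => radialKernel y * |u (x + δ • y)| ^ q :=
    integrable_radialKernel_mul (g := fun z => |u z| ^ q)
      (hu.1.continuousOn.abs.rpow_const fun _ _ => Or.inr (by linarith)) hδ hx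
  have habs : Integrable fun y => radialKernel y * |u (x + δ • y)| :=
    integrable_radialKernel_mul (g := fun z => |u z|) hu.1.continuousOn.abs hδ hx
  have hk : Integrable (radialKernel : EuclideanSpace ℝ (Fin N) → ℝ) :=
    continuous_radialKernel.integrable_of_hasCompactSupport hasCompactSupport_radialKernel
  have hmean := hu.abs_mul_integral_radialKernel_le hδ hx
  rcases (abs_nonneg (u x)).eq_or_lt with hM | hM
  · rw [← hM, Real.zero_rpow (by linarith), zero_mul]
    exact integral_nonneg fun y =>
      mul_nonneg (radialKernel_nonneg y) (Real.rpow_nonneg (abs_nonneg _) _)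
  set M := |u x|
  have hpt : ∀ y, M ^ q * (1 - q) * radialKernel y +
      M ^ q * q / M * (radialKernel y * |u (x + δ • y)|) ≤
        radialKernel y * |u (x + δ • y)| ^ q := by
    intro y
    have h1 := one_add_mul_self_le_rpow_one_add (s := |u (x + δ • y)| / M - 1)
      (by linarith [div_nonneg (abs_nonneg (u (x + δ • y))) hM.le]) hq
    rw [add_sub_cancel, Real.div_rpow (abs_nonneg _) hM.le,
      le_div_iff₀ (Real.rpow_pos_of_pos hM q)] at h1
    refine le_trans (le_of_eq ?_) (mul_le_mul_of_nonneg_left h1 (radialKernel_nonneg y))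
    ring
  have hint := integral_mono ((hk.const_mul _).add (habs.const_mul _)) hpow hpt
  refine le_trans ?_ hint
  simp only [Pi.add_apply]
  rw [integral_add (hk.const_mul _) (habs.const_mul _), integral_const_mul, integral_const_mul]
  have h2 : 0 ≤ M ^ q * q / M := by positivity
  have h3 := mul_le_mul_of_nonneg_left hmean h2
  have h4 : M ^ q * q / M * (M * ∫ y : EuclideanSpace ℝ (Fin N), radialKernel y) =
      M ^ q * q * ∫ y : EuclideanSpace ℝ (Fin N), radialKernel y := by
    field_simp
  rw [h4] at h3
  linarith

/-- The maximum principle: on a closed ball, `|u|` is maximal at some boundary point. -/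
lemma IsHarmonicOn.exists_norm_eq_forall_abs_le {N : ℕ} (hN : 2 ≤ N)
    {u : EuclideanSpace ℝ (Fin N) → ℝ} (hu : IsHarmonicOn N u (ball 0 1)) {r : ℝ}
    (hr0 : 0 ≤ r) (hr1 : r < 1) :
    ∃ z, ‖z‖ = r ∧ ∀ x, ‖x‖ ≤ r → |u x| ≤ |u z| := by
  have hsub : closedBall (0 : EuclideanSpace ℝ (Fin N)) r ⊆ ball 0 1 :=
    closedBall_subset_ball hr1
  have hcont : ContinuousOn (fun x => |u x|) (closedBall 0 r) :=
    (hu.1.continuousOn.mono hsub).abs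
  have hcpt := isCompact_closedBall (0 : EuclideanSpace ℝ (Fin N)) r
  obtain ⟨b, hb, hbmax⟩ := hcpt.exists_isMaxOn ⟨0, by simpa using hr0⟩ hcont
  have hKcpt : IsCompact (closedBall 0 r ∩ (fun x => |u x|) ⁻¹' Ici |u b|) :=
    hcpt.of_isClosed_subset (hcont.preimage_isClosed_of_isClosed isClosed_closedBall isClosed_Ici)
      inter_subset_left
  obtain ⟨a, ⟨ha, hab⟩, hamax⟩ := hKcpt.exists_isMaxOn ⟨b, hb, le_refl |u b|⟩
    continuous_norm.continuousOn
  rw [mem_preimage, mem_Ici] at hab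
  have hle : ∀ x, ‖x‖ ≤ r → |u x| ≤ |u a| := fun x hx =>
    (hbmax (by simpa using hx)).trans hab
  rw [mem_closedBall_zero_iff] at ha
  refine ⟨a, ha.antisymm (not_lt.1 fun har => ?_), hle⟩
  obtain ⟨δ, hδ, hδr⟩ : ∃ δ, 0 < δ ∧ ‖a‖ + δ ≤ r := ⟨r - ‖a‖, by linarith, by linarith⟩
  have hint := integrable_radialKernel_mul (g := fun z => |u a| - |u z|)
    (continuousOn_const.sub hu.1.continuousOn.abs) (x := a) hδ (by linarith)
  have habs := integrable_radialKernel_mul (g := fun z => |u z|)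
    hu.1.continuousOn.abs (x := a) hδ (by linarith)
  have hk : Integrable (radialKernel : EuclideanSpace ℝ (Fin N) → ℝ) :=
    continuous_radialKernel.integrable_of_hasCompactSupport hasCompactSupport_radialKernel
  obtain ⟨s, hs0, hs1, hs⟩ := exists_radius_radialKernel_pos N
  obtain ⟨w, hw1, hwa⟩ : ∃ w : EuclideanSpace ℝ (Fin N), ‖w‖ = 1 ∧ a = ‖a‖ • w := by
    rcases eq_or_ne a 0 with rfl | h0
    · exact ⟨EuclideanSpace.single ⟨0, by omega⟩ 1, by simp, by simp⟩
    · exact ⟨‖a‖⁻¹ • a, norm_smul_inv_norm h0, by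
        rw [smul_smul, mul_inv_cancel₀ (norm_ne_zero_iff.2 h0), one_smul]⟩
  have hws : ‖s • w‖ = s := by rw [norm_smul, hw1, mul_one, Real.norm_of_nonneg hs0.le]
  have hnorm : ‖a + δ • s • w‖ = ‖a‖ + δ * s := by
    nth_rewrite 1 [hwa]
    rw [smul_smul, ← add_smul, norm_smul, hw1, mul_one, Real.norm_of_nonneg (by positivity)]
  have hlt : |u (a + δ • s • w)| < |u a| := by
    refine lt_of_not_ge fun hge => ?_
    have hmem : a + δ • s • w ∈ closedBall (0 : EuclideanSpace ℝ (Fin N)) r ∩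
        (fun x => |u x|) ⁻¹' Ici |u b| := by
      refine ⟨?_, hab.trans hge⟩
      rw [mem_closedBall_zero_iff, hnorm]
      nlinarith
    have : ‖a + δ • s • w‖ ≤ ‖a‖ := hamax hmem
    rw [hnorm] at this
    nlinarith [mul_pos hδ hs0]
  have hnonneg : ∀ y, 0 ≤ radialKernel y * (|u a| - |u (a + δ • y)|) := by
    intro y
    rcases le_or_gt ‖y‖ 1 with hy | hy
    · refine mul_nonneg (radialKernel_nonneg y) (sub_nonneg.2 (hle _ ?_))
      exact (norm_add_smul_sub_le hδ.le hy).2.trans hδr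
    · simp [radialKernel_eq_zero hy]
  have hcontAt : ContinuousAt (fun y => radialKernel y * (|u a| - |u (a + δ • y)|)) (s • w) := by
    refine continuous_radialKernel.continuousAt.mul (continuousAt_const.sub (ContinuousAt.abs ?_))
    refine ContinuousAt.comp (g := u) (f := fun y => a + δ • y) ?_ (by fun_prop)
    refine hu.1.continuousOn.continuousAt (isOpen_ball.mem_nhds ?_)
    rw [mem_ball_zero_iff, hnorm]
    nlinarith
  have hpos : 0 < ∫ y, radialKernel y * (|u a| - |u (a + δ • y)|) := by
    rw [integral_pos_iff_support_of_nonneg hnonneg hint]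
    have hne := hcontAt.eventually_ne (y := 0)
      (mul_pos (hs _ hws) (sub_pos.2 hlt)).ne'
    exact Measure.measure_pos_of_mem_nhds volume hne
  simp_rw [mul_sub] at hpos
  rw [integral_sub (hk.mul_const _) habs, integral_mul_const] at hpos
  have := hu.abs_mul_integral_radialKernel_le (x := a) hδ (by linarith)
  linarith

lemma lintegral_comp_add_smul {N : ℕ} (G : EuclideanSpace ℝ (Fin N) → ENNReal)
    (z : EuclideanSpace ℝ (Fin N)) {δ : ℝ} (hδ : 0 < δ) :
    ∫⁻ y, G (z + δ • y) = ENNReal.ofReal (δ ^ N)⁻¹ * ∫⁻ x, G x := by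
  calc ∫⁻ y, G (z + δ • y)
      = ∫⁻ x, G (z + x) ∂(Measure.map (fun y : EuclideanSpace ℝ (Fin N) => δ • y) volume) :=
        (lintegral_map_equiv (fun x => G (z + x))
          (Homeomorph.smulOfNeZero δ hδ.ne').toMeasurableEquiv).symm
    _ = ENNReal.ofReal (δ ^ N)⁻¹ * ∫⁻ x, G x := by
        rw [Measure.map_addHaar_smul _ hδ.ne', lintegral_smul_measure,
          lintegral_add_left_eq_self, finrank_euclideanSpace_fin,
          abs_of_nonneg (by positivity), smul_eq_mul]

/-- A pointwise bound for a harmonic function by its weighted integral over an annulus. -/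
lemma IsHarmonicOn.ofReal_abs_rpow_le_lintegral_annulus {N : ℕ} (hN : 2 ≤ N) {q : ℝ}
    (hq : 1 ≤ q) {γ r δ : ℝ} (hδ : 0 < δ) (hγ : γ < r - δ) (hr : r + 2 * δ ≤ 1) :
    ∃ C : ℝ, 0 ≤ C ∧ ∀ u : EuclideanSpace ℝ (Fin N) → ℝ, IsHarmonicOn N u (ball 0 1) →
      ∀ z : EuclideanSpace ℝ (Fin N), ‖z‖ = r → ENNReal.ofReal (|u z| ^ q) ≤ ENNReal.ofReal C *
        ∫⁻ x in {x : EuclideanSpace ℝ (Fin N) | γ < ‖x‖ ∧ ‖x‖ < 1},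
          ENNReal.ofReal (|u x| ^ q * (1 - ‖x‖)) := by
  set A := {x : EuclideanSpace ℝ (Fin N) | γ < ‖x‖ ∧ ‖x‖ < 1}
  have hAm : MeasurableSet A :=
    (measurableSet_lt measurable_const measurable_norm).inter
      (measurableSet_lt measurable_norm measurable_const)
  obtain ⟨K, hK⟩ := (hasCompactSupport_radialKernel (N := N)).exists_bound_of_continuous
    continuous_radialKernel
  have hK0 : 0 ≤ K := (norm_nonneg _).trans (hK 0)
  set I := ∫ y : EuclideanSpace ℝ (Fin N), radialKernel y
  have hIpos : 0 < I := integral_radialKernel_pos hN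
  refine ⟨I⁻¹ * (K / δ * (δ ^ N)⁻¹), by positivity, fun u hu z hz => ?_⟩
  set g : EuclideanSpace ℝ (Fin N) → ENNReal := fun x => ENNReal.ofReal (|u x| ^ q * (1 - ‖x‖))
  have hzδ : ‖z‖ + δ < 1 := by linarith
  have hpow : Integrable fun y => radialKernel y * |u (z + δ • y)| ^ q :=
    integrable_radialKernel_mul (g := fun z => |u z| ^ q)
      (hu.1.continuousOn.abs.rpow_const fun _ _ => Or.inr (by linarith)) hδ hzδ
  have hpt : ∀ y, ENNReal.ofReal (radialKernel y * |u (z + δ • y)| ^ q) ≤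
      ENNReal.ofReal (K / δ) * A.indicator g (z + δ • y) := by
    intro y
    rcases le_or_gt ‖y‖ 1 with hy | hy
    · obtain ⟨h1, h2⟩ := norm_add_smul_sub_le (x := z) hδ.le hy
      rw [indicator_of_mem (show z + δ • y ∈ A from ⟨by linarith, by linarith⟩),
        ← ENNReal.ofReal_mul (by positivity)]
      refine ENNReal.ofReal_le_ofReal ?_
      have h3 : 0 ≤ |u (z + δ • y)| ^ q := by positivity
      have h4 : radialKernel y ≤ K := (le_abs_self _).trans (hK y)
      calc radialKernel y * |u (z + δ • y)| ^ q ≤ K * |u (z + δ • y)| ^ q := by gcongr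
        _ = K / δ * (|u (z + δ • y)| ^ q * δ) := by field_simp
        _ ≤ _ := by gcongr; linarith
    · simp [radialKernel_eq_zero hy]
  have hmain : ENNReal.ofReal (|u z| ^ q * I) ≤
      ENNReal.ofReal (K / δ * (δ ^ N)⁻¹) * ∫⁻ x in A, g x := by
    calc ENNReal.ofReal (|u z| ^ q * I)
        ≤ ENNReal.ofReal (∫ y, radialKernel y * |u (z + δ • y)| ^ q) :=
          ENNReal.ofReal_le_ofReal (hu.abs_rpow_mul_integral_radialKernel_le hq hδ hzδ)
      _ = ∫⁻ y, ENNReal.ofReal (radialKernel y * |u (z + δ • y)| ^ q) :=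
          ofReal_integral_eq_lintegral_ofReal hpow (Filter.Eventually.of_forall fun y =>
            mul_nonneg (radialKernel_nonneg y) (Real.rpow_nonneg (abs_nonneg _) _))
      _ ≤ ∫⁻ y, ENNReal.ofReal (K / δ) * A.indicator g (z + δ • y) := lintegral_mono hpt
      _ = ENNReal.ofReal (K / δ * (δ ^ N)⁻¹) * ∫⁻ x in A, g x := by
          rw [lintegral_const_mul' _ _ ENNReal.ofReal_ne_top, lintegral_comp_add_smul _ _ hδ,
            lintegral_indicator hAm, ENNReal.ofReal_mul (by positivity), mul_assoc]
  calc ENNReal.ofReal (|u z| ^ q)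
      = ENNReal.ofReal I⁻¹ * ENNReal.ofReal (|u z| ^ q * I) := by
        rw [← ENNReal.ofReal_mul (by positivity)]
        congr 1
        field_simp
    _ ≤ ENNReal.ofReal I⁻¹ * (ENNReal.ofReal (K / δ * (δ ^ N)⁻¹) * ∫⁻ x in A, g x) := by gcongr
    _ = _ := by rw [← mul_assoc, ← ENNReal.ofReal_mul (by positivity)]

/-- For every γ ∈ (0,1) there is c(γ) > 0 (depending only on γ, N, q) such that for every u
    harmonic on the unit ball with ∫_{γ<|x|<1} |u|^q (1−|x|) dx < ∞,
    ∫_B |u|^q (1−|x|) dx ≤ c(γ) ∫_{γ<|x|<1} |u|^q (1−|x|) dx. -/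
theorem stmt_4 (N : ℕ) (hN : 2 ≤ N) (q : ℝ) (hq : 1 ≤ q)
    (γ : ℝ) (hγ : γ ∈ Ioo (0 : ℝ) 1) :
    ∃ c : ℝ, 0 < c ∧
      ∀ u : EuclideanSpace ℝ (Fin N) → ℝ, IsHarmonicOn N u (ball 0 1) →
        (∫⁻ x in {x : EuclideanSpace ℝ (Fin N) | γ < ‖x‖ ∧ ‖x‖ < 1},
            ENNReal.ofReal (|u x| ^ q * (1 - ‖x‖)) < ⊤) →
        ∫⁻ x in ball (0 : EuclideanSpace ℝ (Fin N)) 1,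
            ENNReal.ofReal (|u x| ^ q * (1 - ‖x‖))
          ≤ ENNReal.ofReal c *
            ∫⁻ x in {x : EuclideanSpace ℝ (Fin N) | γ < ‖x‖ ∧ ‖x‖ < 1},
              ENNReal.ofReal (|u x| ^ q * (1 - ‖x‖)) := by
  obtain ⟨hγ0, hγ1⟩ := hγ
  set r := (1 + γ) / 2 with hr
  obtain ⟨C, hC0, hC⟩ := IsHarmonicOn.ofReal_abs_rpow_le_lintegral_annulus hN hq
    (γ := γ) (r := r) (δ := (1 - γ) / 4) (by linarith) (by linarith) (by linarith)
  set V := (volume (closedBall (0 : EuclideanSpace ℝ (Fin N)) r)).toReal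
  refine ⟨C * V + 1, by positivity, fun u hu _ => ?_⟩
  set A := {x : EuclideanSpace ℝ (Fin N) | γ < ‖x‖ ∧ ‖x‖ < 1}
  obtain ⟨z, hz, hmax⟩ := hu.exists_norm_eq_forall_abs_le hN (r := r) (by linarith) (by linarith)
  have hcover : ball (0 : EuclideanSpace ℝ (Fin N)) 1 ⊆ closedBall 0 r ∪ A := by
    intro x hx
    rw [mem_ball_zero_iff] at hx
    rcases le_or_gt ‖x‖ r with h | h
    · exact Or.inl (by simpa using h)
    · exact Or.inr ⟨by linarith, hx⟩
  have hinner : ∫⁻ x in closedBall (0 : EuclideanSpace ℝ (Fin N)) r,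
      ENNReal.ofReal (|u x| ^ q * (1 - ‖x‖)) ≤
        ENNReal.ofReal (C * V) * ∫⁻ x in A, ENNReal.ofReal (|u x| ^ q * (1 - ‖x‖)) := by
    calc ∫⁻ x in closedBall (0 : EuclideanSpace ℝ (Fin N)) r,
          ENNReal.ofReal (|u x| ^ q * (1 - ‖x‖))
        ≤ ∫⁻ _ in closedBall (0 : EuclideanSpace ℝ (Fin N)) r, ENNReal.ofReal (|u z| ^ q) := by
          refine setLIntegral_mono' measurableSet_closedBall fun x hx => ?_
          refine ENNReal.ofReal_le_ofReal ?_
          refine (mul_le_of_le_one_right (by positivity)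
            (by linarith [norm_nonneg x])).trans ?_
          exact Real.rpow_le_rpow (abs_nonneg _) (hmax x (by simpa using hx)) (by linarith)
      _ = ENNReal.ofReal V * ENNReal.ofReal (|u z| ^ q) := by
          rw [setLIntegral_const, ENNReal.ofReal_toReal measure_closedBall_lt_top.ne, mul_comm]
      _ ≤ ENNReal.ofReal V * (ENNReal.ofReal C *
            ∫⁻ x in A, ENNReal.ofReal (|u x| ^ q * (1 - ‖x‖))) := by
          gcongr
          exact hC u hu z hz
      _ = _ := by rw [← mul_assoc, ← ENNReal.ofReal_mul ENNReal.toReal_nonneg, mul_comm V]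
  calc ∫⁻ x in ball (0 : EuclideanSpace ℝ (Fin N)) 1, ENNReal.ofReal (|u x| ^ q * (1 - ‖x‖))
      ≤ ∫⁻ x in closedBall 0 r ∪ A, ENNReal.ofReal (|u x| ^ q * (1 - ‖x‖)) :=
        lintegral_mono_set hcover
    _ ≤ _ := lintegral_union_le _ _ _
    _ ≤ _ := add_le_add_left hinner _
    _ = _ := by
        rw [ENNReal.ofReal_add (by positivity) zero_le_one, ENNReal.ofReal_one, add_mul, one_mul]
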